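/- The explicit 36×36 matrix A over ZMod 3 given in the Appendix (first matrix, with rows such as 1 1 1 1 1 1 1 0 0 0 0 0 1 1 1 1 1 1 1 1 0 0 0 0 0 0 0 0 0 0 0 0 0 0 0 0, reading each block as the set of column indices with entry 1) is the incidence matrix of a symmetric 2-(36,15,6) design: every row has exactly 15 ones and every two distinct columns share a one in exactly 6 common rows; moreover the F₃-row span of A is a self-dual ternary code of length 36 with minimum weight 9 having exactly 104 codewords of weight 9. -/

import Mathlib

/-- `C` is a self-dual ternary code of length 36: it coincides with its orthogonal
complement with respect to the standard dot product on `(ZMod 3)^36`. -/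
def IsSelfDualCode (C : Submodule (ZMod 3) (Fin 36 → ZMod 3)) : Prop :=
  ∀ x : Fin 36 → ZMod 3, x ∈ C ↔ ∀ y ∈ C, ∑ i, x i * y i = 0

/-- The minimum (Hamming) weight of `C` is 9, i.e. `C` is near-extremal. -/
def MinWeightNine (C : Submodule (ZMod 3) (Fin 36 → ZMod 3)) : Prop :=
  IsLeast {w : ℕ | ∃ x ∈ C, x ≠ 0 ∧ hammingNorm x = w} 9

/-- The number of codewords of `C` of Hamming weight exactly 9. -/
noncomputable def A9 (C : Submodule (ZMod 3) (Fin 36 → ZMod 3)) : ℕ :=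
  Nat.card {x : Fin 36 → ZMod 3 // x ∈ C ∧ hammingNorm x = 9}

/-- The rows of the incidence matrix from the Appendix of the paper. -/
def rows104 : List (List ℕ) :=
  [[1, 1, 1, 1, 1, 1, 1, 0, 0, 0, 0, 0, 1, 1, 1, 1, 1, 1, 1, 1, 0, 0, 0, 0, 0, 0, 0, 0, 0, 0, 0, 0, 0, 0, 0, 0],
   [1, 1, 1, 1, 1, 1, 0, 1, 0, 0, 0, 0, 0, 0, 0, 0, 0, 0, 0, 0, 1, 1, 1, 1, 1, 1, 1, 1, 0, 0, 0, 0, 0, 0, 0, 0],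
   [1, 1, 1, 0, 0, 0, 1, 1, 1, 1, 0, 0, 1, 1, 0, 0, 0, 0, 0, 0, 1, 1, 0, 0, 0, 0, 0, 0, 1, 1, 1, 1, 0, 0, 0, 0],
   [1, 1, 0, 1, 0, 0, 1, 1, 1, 1, 0, 0, 0, 0, 1, 1, 0, 0, 0, 0, 0, 0, 1, 1, 0, 0, 0, 0, 0, 0, 0, 0, 1, 1, 1, 1],
   [1, 1, 0, 0, 0, 0, 0, 0, 0, 0, 1, 0, 1, 1, 1, 1, 0, 0, 0, 0, 0, 0, 0, 0, 1, 1, 1, 1, 1, 1, 0, 0, 0, 0, 1, 1],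
   [1, 1, 0, 0, 0, 0, 0, 0, 0, 0, 0, 1, 0, 0, 0, 0, 1, 1, 1, 1, 1, 1, 1, 1, 0, 0, 0, 0, 1, 1, 0, 0, 0, 0, 1, 1],
   [1, 0, 1, 1, 0, 0, 1, 1, 0, 0, 1, 1, 0, 0, 0, 0, 1, 1, 0, 0, 0, 0, 0, 0, 1, 1, 0, 0, 1, 1, 0, 0, 1, 1, 0, 0],
   [1, 0, 1, 0, 0, 1, 0, 0, 0, 1, 1, 1, 1, 0, 1, 0, 1, 0, 0, 0, 1, 0, 1, 0, 0, 0, 1, 0, 0, 0, 1, 0, 1, 0, 1, 0],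
   [1, 0, 1, 0, 0, 1, 0, 0, 0, 1, 1, 1, 0, 1, 0, 1, 0, 1, 0, 0, 0, 1, 0, 1, 0, 0, 0, 1, 0, 0, 0, 1, 0, 1, 0, 1],
   [1, 0, 0, 1, 1, 0, 0, 0, 0, 1, 0, 0, 0, 0, 1, 0, 1, 0, 0, 1, 0, 1, 0, 0, 1, 0, 0, 1, 1, 0, 1, 1, 0, 1, 1, 0],
   [1, 0, 0, 1, 1, 0, 0, 0, 0, 1, 0, 0, 0, 0, 0, 1, 0, 1, 1, 0, 1, 0, 0, 0, 0, 1, 1, 0, 0, 1, 1, 1, 1, 0, 0, 1],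
   [1, 0, 0, 0, 1, 1, 1, 0, 1, 0, 0, 1, 1, 0, 0, 0, 0, 0, 1, 0, 0, 0, 0, 1, 1, 0, 1, 0, 1, 0, 1, 0, 0, 1, 0, 1],
   [1, 0, 0, 0, 1, 1, 1, 0, 1, 0, 0, 1, 0, 1, 0, 0, 0, 0, 0, 1, 0, 0, 1, 0, 0, 1, 0, 1, 0, 1, 0, 1, 1, 0, 1, 0],
   [1, 0, 0, 0, 0, 0, 0, 1, 1, 0, 1, 0, 1, 0, 0, 1, 0, 1, 1, 1, 0, 1, 1, 0, 1, 0, 0, 1, 0, 0, 1, 0, 1, 0, 0, 0],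
   [1, 0, 0, 0, 0, 0, 0, 1, 1, 0, 1, 0, 0, 1, 1, 0, 1, 0, 1, 1, 1, 0, 0, 1, 0, 1, 1, 0, 0, 0, 0, 1, 0, 1, 0, 0],
   [0, 1, 1, 1, 0, 0, 1, 1, 0, 0, 1, 1, 0, 0, 0, 0, 0, 0, 1, 1, 0, 0, 0, 0, 0, 0, 1, 1, 0, 0, 1, 1, 0, 0, 1, 1],
   [0, 1, 1, 0, 0, 1, 0, 0, 1, 0, 0, 0, 0, 0, 1, 0, 0, 1, 0, 1, 1, 0, 0, 0, 0, 1, 0, 1, 1, 0, 1, 0, 1, 1, 0, 1],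
   [0, 1, 1, 0, 0, 1, 0, 0, 1, 0, 0, 0, 0, 0, 0, 1, 1, 0, 1, 0, 0, 1, 0, 0, 1, 0, 1, 0, 0, 1, 0, 1, 1, 1, 1, 0],
   [0, 1, 0, 1, 1, 0, 0, 0, 1, 0, 1, 1, 1, 0, 0, 1, 1, 0, 0, 0, 1, 0, 0, 1, 0, 0, 0, 1, 1, 0, 0, 1, 1, 0, 0, 0],
   [0, 1, 0, 1, 1, 0, 0, 0, 1, 0, 1, 1, 0, 1, 1, 0, 0, 1, 0, 0, 0, 1, 1, 0, 0, 0, 1, 0, 0, 1, 1, 0, 0, 1, 0, 0],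
   [0, 1, 0, 0, 1, 1, 0, 1, 0, 1, 1, 0, 1, 0, 0, 0, 0, 1, 1, 0, 0, 0, 1, 0, 0, 1, 0, 0, 1, 0, 0, 1, 0, 1, 1, 0],
   [0, 1, 0, 0, 1, 1, 0, 1, 0, 1, 1, 0, 0, 1, 0, 0, 1, 0, 0, 1, 0, 0, 0, 1, 1, 0, 0, 0, 0, 1, 1, 0, 1, 0, 0, 1],
   [0, 1, 0, 0, 0, 0, 1, 0, 0, 1, 0, 1, 1, 0, 1, 0, 0, 1, 0, 1, 0, 1, 0, 1, 1, 1, 1, 0, 0, 0, 0, 1, 1, 0, 0, 0],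
   [0, 1, 0, 0, 0, 0, 1, 0, 0, 1, 0, 1, 0, 1, 0, 1, 1, 0, 1, 0, 1, 0, 1, 0, 1, 1, 0, 1, 0, 0, 1, 0, 0, 1, 0, 0],
   [0, 0, 1, 1, 0, 0, 0, 0, 1, 0, 0, 0, 1, 1, 0, 0, 1, 1, 0, 0, 0, 0, 1, 1, 1, 1, 0, 0, 0, 0, 1, 1, 0, 0, 1, 1],
   [0, 0, 1, 1, 0, 0, 0, 0, 0, 1, 0, 0, 1, 1, 0, 0, 0, 0, 1, 1, 0, 0, 1, 1, 0, 0, 1, 1, 1, 1, 0, 0, 1, 1, 0, 0],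
   [0, 0, 1, 0, 1, 0, 1, 0, 1, 1, 1, 0, 0, 0, 1, 0, 0, 1, 1, 0, 1, 0, 0, 1, 1, 0, 0, 1, 0, 1, 0, 0, 0, 0, 1, 0],
   [0, 0, 1, 0, 1, 0, 1, 0, 1, 1, 1, 0, 0, 0, 0, 1, 1, 0, 0, 1, 0, 1, 1, 0, 0, 1, 1, 0, 1, 0, 0, 0, 0, 0, 0, 1],
   [0, 0, 1, 0, 1, 0, 0, 1, 0, 0, 0, 1, 1, 0, 1, 1, 0, 0, 0, 1, 1, 0, 1, 0, 1, 0, 0, 0, 0, 1, 0, 1, 0, 1, 0, 1],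
   [0, 0, 1, 0, 1, 0, 0, 1, 0, 0, 0, 1, 0, 1, 1, 1, 0, 0, 1, 0, 0, 1, 0, 1, 0, 1, 0, 0, 1, 0, 1, 0, 1, 0, 1, 0],
   [0, 0, 0, 1, 0, 1, 1, 0, 0, 0, 1, 0, 1, 0, 0, 1, 0, 0, 0, 1, 1, 1, 0, 1, 0, 1, 0, 0, 0, 1, 1, 0, 0, 1, 1, 0],
   [0, 0, 0, 1, 0, 1, 1, 0, 0, 0, 1, 0, 0, 1, 1, 0, 0, 0, 1, 0, 1, 1, 1, 0, 1, 0, 0, 0, 1, 0, 0, 1, 1, 0, 0, 1],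
   [0, 0, 0, 1, 0, 1, 0, 1, 1, 1, 0, 1, 1, 0, 1, 0, 1, 0, 1, 0, 0, 1, 0, 0, 0, 1, 0, 1, 0, 1, 0, 0, 0, 0, 0, 1],
   [0, 0, 0, 1, 0, 1, 0, 1, 1, 1, 0, 1, 0, 1, 0, 1, 0, 1, 0, 1, 1, 0, 0, 0, 1, 0, 1, 0, 1, 0, 0, 0, 0, 0, 1, 0],
   [0, 0, 0, 0, 1, 0, 1, 1, 0, 0, 0, 0, 1, 1, 0, 0, 1, 1, 0, 0, 1, 1, 0, 0, 0, 0, 1, 1, 0, 0, 0, 0, 1, 1, 1, 1],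
   [0, 0, 0, 0, 0, 1, 1, 1, 0, 0, 0, 0, 0, 0, 1, 1, 1, 1, 0, 0, 0, 0, 1, 1, 0, 0, 1, 1, 1, 1, 1, 1, 0, 0, 0, 0]]

/-- The incidence matrix `A` from the Appendix, as a matrix over `ZMod 3`. -/
def A104 : Matrix (Fin 36) (Fin 36) (ZMod 3) :=
  fun i j => (((rows104.getD i []).getD j 0 : ℕ) : ZMod 3)

/-- The `F₃`-row span of the matrix `A104`. -/
def C104 : Submodule (ZMod 3) (Fin 36 → ZMod 3) :=
  Submodule.span (ZMod 3) (Set.range fun i => A104 i)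

structure Row where
  pos : Fin 36
  p : ℕ
  q : ℕ
  cp : ℕ
  cq : ℕ

def gen1 : List Row :=
  [⟨0, 20781244417, 20403748864, 291949, 17517⟩, ⟨1, 51315908610, 15068069888, 390799, 123535⟩,
   ⟨2, 32389111812, 42467328, 846494, 796822⟩, ⟨3, 67023544328, 32258924544, 615099, 8195⟩, ⟨4, 67552026640, 33192280064, 585451, 32969⟩,
   ⟨5, 34263965728, 3658129408, 618175, 550938⟩, ⟨6, 58630242368, 58051264512, 391933, 327756⟩,
   ⟨7, 24644329600, 7457636352, 652499, 557264⟩, ⟨8, 33800364288, 4775780352, 899089, 98305⟩,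
   ⟨9, 46685397504, 45275455488, 112862, 47250⟩, ⟨10, 50103223296, 37079875584, 309487, 32834⟩,
   ⟨11, 29476169728, 26047184896, 892093, 787600⟩, ⟨12, 65443737600, 39065755648, 895583, 598557⟩,
   ⟨14, 55780098048, 20006862848, 818943, 556671⟩, ⟨16, 17125539840, 11081482240, 100541, 67616⟩,
   ⟨18, 67860430848, 22624600064, 892605, 590880⟩, ⟨20, 68466769920, 44570771456, 908383, 613405⟩,
   ⟨24, 68702699520, 27279753216, 900322, 592066⟩]

def gen2 : List Row :=
  [⟨13, 15295, 2199, 788398, 786474⟩, ⟨15, 53223, 1092, 821211, 34761⟩, ⟨17, 200446, 2638, 8159, 14⟩,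
   ⟨19, 789439, 642, 40883, 8064⟩, ⟨21, 3149787, 2184, 792667, 786499⟩, ⟨22, 5594296, 1399968, 362490, 361930⟩,
   ⟨23, 9788367, 67, 860111, 268800⟩, ⟨25, 50333567, 321, 827391, 463⟩, ⟨26, 84237249, 16800257, 302447, 39170⟩,
   ⟨27, 151347132, 330764, 821198, 525068⟩, ⟨28, 286350267, 1065483, 898837, 98577⟩, ⟨29, 554783986, 16846946, 898998, 14102⟩,
   ⟨30, 1091914531, 84738, 374585, 332321⟩, ⟨31, 2165657599, 18090244, 371944, 43016⟩, ⟨32, 4313126398, 17892388, 887789, 101164⟩,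
   ⟨33, 8608096062, 267556, 859808, 789024⟩, ⟨34, 17197980157, 1053092, 573395, 572739⟩, ⟨35, 34377848410, 17055770, 835296, 524800⟩]

def bigA : ℕ :=
  84184238774080243927169721986181414679512484059634057066926426440041606908500530392593158981507067563122003489796960522866099249150844897550375691364772238461462884193576589176511979197433314764259735282753585735178425947750528753522600740604206959309181250751738446767403199196423547126298184561357098996847179610196221966991866706416955530101791710016596257132170601498092385665389949055

def lights : List (ℕ × ℕ) :=
  [(0, 0), (6494906496, 18882560), (9715095680, 34607104), (34976696448, 34968176640), (17595697280, 17591437312),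
   (34976696448, 8519808), (17595697280, 4259968), (6494906496, 6476023936), (9715095680, 9680488576),
   (5380015168, 8683520), (10743465024, 4734976), (34796090432, 34661868544), (17800705088, 17733587968),
   (17800705088, 67117120), (34796090432, 134221888), (5380015168, 5371331648), (10743465024, 10738730048),
   (38694028064, 38273024), (25797329696, 25427968), (38694028064, 38655755040), (25797329696, 25771901728),
   (1359504144, 17309696), (2718208784, 33820672), (1359504144, 1342194448), (2718208784, 2684388112),
   (11408804872, 2281702400), (5704797192, 1140851712), (25847529672, 25778192384), (38794232008, 38658899968),
   (3422553512, 3221225504), (9969336344, 8859418624), (6999506968, 4833935360), (950149144, 413270032),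
   (877727768, 609288208), (11408804872, 9127102472), (5704797192, 4563945480), (25847529672, 69337288),
   (38794232008, 135332040), (3422553512, 201328008), (950149144, 536879112), (877727768, 268439560),
   (9969336344, 1109917720), (6999506968, 2165571608), (26862554116, 8590067712), (40836860932, 4295034880),
   (1409376452, 1342185472), (2818740420, 2684358656), (39762313252, 35433512960), (27934638116, 19327369216),
   (51611066404, 34427002912), (51682316324, 17314189344), (12885101140, 12884901904), (26862554116, 18272486404),
   (40836860932, 36541826052), (1409376452, 67190980), (2818740420, 134381764), (51611066404, 17184063492),
   (51682316324, 34368126980), (27934638116, 8607268900), (39762313252, 4328800292), (12885101140, 199236),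
   (3239674370, 1074331648), (3257287170, 2147876864), (39401300482, 38730211840), (26243764738, 25908220416),
   (51539658146, 50176), (62915882, 50331904), (12885099690, 1184), (808453514, 808452232), (799146, 296),
   (39401300482, 671088642), (26243764738, 335544322), (3239674370, 2165342722), (3257287170, 1109410306),
   (51539658146, 51539607970), (808453514, 1282), (799146, 798850), (12885099690, 12885098506),
   (62915882, 12583978), (13055328513, 4462739456), (12970115329, 8673820672), (19868623105, 2688622848),
   (35710505217, 1350701312), (808454737, 3147776), (801301, 786944), (3422554197, 2128), (51539659333, 51539656772),
   (62915157, 532), (344481827, 344457250), (675581987, 675545122), (34398609427, 5242882), (17207267347, 10485762),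
   (19868623105, 17180000257), (35710505217, 34359803905), (13055328513, 8592589057), (12970115329, 4296294657),
   (808454737, 805306961), (51539659333, 2561), (62915157, 62914625), (3422554197, 3422552069),
   (801301, 14357), (344481827, 24577), (675581987, 36865), (34398609427, 34393366545), (17207267347, 17196781585)]

def bitv (p i : ℕ) : ℕ := Nat.land 1 (Nat.shiftRight p i)

/-- Digit (0, 1 or 2) of a bit-sliced ternary vector. -/
def dn (p q i : ℕ) : ℕ := Nat.mul (bitv p i) (Nat.succ (bitv q i))

def dec (p q : ℕ) (i : Fin 36) : ZMod 3 := (dn p q i : ℕ)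

def ent (i j : ℕ) : ℕ := bitv bigA (Nat.add (Nat.mul 36 i) j)

def sumN (n : ℕ) (f : ℕ → ℕ) : ℕ :=
  Nat.rec (motive := fun _ => ℕ) 0 (fun i s => Nat.add s (f i)) n

def allN (n : ℕ) (f : ℕ → Bool) : Bool :=
  Nat.rec (motive := fun _ => Bool) true (fun i s => and (f i) s) n

def sumL (l : List Row) (f : Row → ℕ) : ℕ :=
  List.rec (motive := fun _ => ℕ) 0 (fun t _ s => Nat.add (f t) s) l

def allL (l : List Row) (f : Row → Bool) : Bool :=
  List.rec (motive := fun _ => Bool) true (fun t _ s => and (f t) s) l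

def force (n : ℕ) (k : ℕ → Bool) : Bool :=
  Nat.rec (motive := fun _ => Bool) (k 0) (fun m _ => k (Nat.succ m)) n

def clr (k : ℕ → Bool) (p : ℕ) : Bool :=
  Nat.rec (motive := fun _ => Bool) false (fun m _ => k (Nat.land (Nat.succ m) m)) p

def heavy (p : ℕ) : Bool :=
  clr (clr (clr (clr (clr (clr (clr (clr (clr (clr (fun _ => true)))))))))) p

def inL (p q : ℕ) : Bool :=
  lights.any fun t => and (Nat.beq t.1 p) (Nat.beq t.2 q)

def test (p q : ℕ) : Bool := force p fun p => or (heavy p) (inL p q)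

def sub0 (x0 x1 y0 y1 : ℕ) : ℕ := Nat.lor (Nat.xor x0 y0) (Nat.xor x1 y1)

def sub1 (x0 x1 y0 y1 : ℕ) : ℕ :=
  Nat.xor (Nat.xor x1 y0) (Nat.xor (Nat.land (Nat.xor x1 y0) (Nat.xor x0 y1))
    (Nat.land (Nat.land (Nat.xor x1 y0) (Nat.xor x0 y1)) x1))

/-- Checks every vector `(p, q) + ∑ c_t • t` with at most `k` nonzero coefficients. -/
def srch (k : ℕ) : List Row → ℕ → ℕ → Bool :=
  Nat.rec (motive := fun _ => List Row → ℕ → ℕ → Bool)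
    (fun _ p q => test p q)
    (fun _ S rs p q => and (test p q) (force p fun p => force q fun q =>
      List.rec (motive := fun _ => Bool) true
        (fun t rs' ih => and (S rs' (sub0 p q t.p t.q) (sub1 p q t.p t.q))
          (and (S rs' (sub0 p q t.p (Nat.xor t.p t.q))
            (sub1 p q t.p (Nat.xor t.p t.q))) ih)) rs)) k

def delta (a b : ℕ) : ℕ := bif Nat.beq a b then 1 else 0

def identChk (G H : List Row) : Bool :=
  allN 36 fun l => allN 36 fun m => Nat.beq (delta l m)
    (Nat.mod (Nat.add (sumL G fun t => Nat.mul (delta l t.pos.val) (dn t.p t.q m))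
      (sumL H fun t => Nat.mul (dn t.p t.q l) (delta m t.pos.val))) 3)

def memChk (G : List Row) : Bool :=
  allL G fun t => allN 36 fun m => Nat.beq (dn t.p t.q m)
    (Nat.mod (sumN 36 fun k => Nat.mul (dn t.cp t.cq k) (ent k m)) 3)

def invChk (p q : ℕ) : Bool :=
  and (Nat.ble p 68719476735) (Nat.beq (Nat.land p q) q)

def ltChk (G : List Row) : Bool :=
  allL G fun t => invChk t.p t.q

theorem srch1 : srch 4 gen1 0 0 = true := by decide +kernel
theorem srch2 : srch 4 gen2 0 0 = true := by decide +kernel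
theorem ident1 : identChk gen1 gen2 = true := by decide +kernel
theorem ident2 : identChk gen2 gen1 = true := by decide +kernel
theorem mem1 : memChk gen1 = true := by decide +kernel
theorem mem2 : memChk gen2 = true := by decide +kernel
theorem lt1 : ltChk gen1 = true := by decide +kernel
theorem lt2 : ltChk gen2 = true := by decide +kernel
theorem entChk : (allN 36 fun i => allN 36 fun j =>
    Nat.beq ((rows104.getD i []).getD j 0) (ent i j)) = true := by decide +kernel
theorem rowChk : (allN 36 fun i => Nat.beq (sumN 36 fun j => ent i j) 15) = true := by
  decide +kernel
theorem colChk : (allN 36 fun x => allN x fun y =>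
    Nat.beq (sumN 36 fun i => Nat.mul (ent i x) (ent i y)) 6) = true := by
  decide +kernel
theorem orthChk : (allN 36 fun x => allN 36 fun y =>
    Nat.beq (Nat.mod (sumN 36 fun i => Nat.mul (ent x i) (ent y i)) 3) 0) = true := by
  decide +kernel
theorem lightsChk : (lights.tail.all fun t => and (invChk t.1 t.2) (and (Nat.beq (sumN 36 fun i => bitv t.1 i) 9)
    (allN 36 fun m => Nat.beq (dn t.1 t.2 m)
      (Nat.mod (sumL gen1 fun r => Nat.mul (dn t.1 t.2 r.pos.val) (dn r.p r.q m)) 3)))) = true := by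
  decide +kernel
theorem lightsNodup : lights.tail.Nodup := by decide +kernel
theorem gen1Nodup : (gen1.map Row.pos ++ gen2.map Row.pos).Nodup := by decide +kernel

theorem bitv_eq (p i : ℕ) : bitv p i = (p.testBit i).toNat := by
  have : bitv p i = 1 &&& (p >>> i) := rfl
  rw [this, Nat.toNat_testBit, Nat.one_and_eq_mod_two, Nat.shiftRight_eq_div_pow]

theorem dn_eq (p q i : ℕ) : dn p q i = (p.testBit i).toNat * ((q.testBit i).toNat + 1) := by
  show bitv p i * (bitv q i + 1) = _
  rw [bitv_eq, bitv_eq]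

theorem sumN_eq (n : ℕ) (f : ℕ → ℕ) : sumN n f = ∑ i : Fin n, f i := by
  rw [Fin.sum_univ_eq_sum_range (fun i => f i)]
  induction n with
  | zero => rfl
  | succ n ih =>
    rw [Finset.sum_range_succ, ← ih]; rfl

theorem allN_eq (n : ℕ) (f : ℕ → Bool) (h : allN n f = true) : ∀ i < n, f i = true := by
  induction n with
  | zero => intro i hi; omega
  | succ n ih =>
    have h' : (f n && allN n f) = true := h
    rw [Bool.and_eq_true] at h'
    intro i hi
    rcases Nat.lt_succ_iff_lt_or_eq.1 hi with h1 | h1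
    · exact ih h'.2 i h1
    · rw [h1]; exact h'.1

theorem sumL_eq (l : List Row) (f : Row → ℕ) : sumL l f = (l.map f).sum := by
  induction l with
  | nil => rfl
  | cons t l ih => rw [List.map_cons, List.sum_cons, ← ih]; rfl

theorem allL_eq (l : List Row) (f : Row → Bool) (h : allL l f = true) : ∀ t ∈ l, f t = true := by
  induction l with
  | nil => intro t ht; simp at ht
  | cons t l ih =>
    have h' : (f t && allL l f) = true := h
    rw [Bool.and_eq_true] at h'
    intro s hs
    rcases List.mem_cons.1 hs with rfl | hs
    · exact h'.1
    · exact ih h'.2 s hs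

theorem force_eq (n : ℕ) (k : ℕ → Bool) : force n k = k n := by
  cases n <;> rfl

theorem beq_nat {a b : ℕ} (h : Nat.beq a b = true) : a = b := Nat.eq_of_beq_eq_true h

theorem cast_mod3 (n : ℕ) : ((n % 3 : ℕ) : ZMod 3) = n := ZMod.natCast_mod n 3

def CInv (p q : ℕ) : Prop :=
  ∀ i, (q.testBit i = true → p.testBit i = true) ∧ (p.testBit i = true → i < 36)

theorem inv_of_chk {p q : ℕ} (h : invChk p q = true) : CInv p q := by
  unfold invChk at h
  rw [Bool.and_eq_true] at h
  have h1 : p ≤ 68719476735 := Nat.le_of_ble_eq_true h.1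
  have h2 : p &&& q = q := beq_nat h.2
  intro i
  constructor
  · intro hq
    rw [← h2, Nat.testBit_and, Bool.and_eq_true] at hq
    exact hq.1
  · intro hp
    by_contra hi
    have : p < 2 ^ i := lt_of_lt_of_le (by omega : p < 2 ^ 36)
      (Nat.pow_le_pow_right (by norm_num) (by omega))
    rw [Nat.testBit_eq_false_of_lt this] at hp
    exact absurd hp (by simp)

theorem sub0_bit (a b c d i : ℕ) : (sub0 a b c d).testBit i =
    ((a.testBit i ^^ c.testBit i) || (b.testBit i ^^ d.testBit i)) := by
  have : sub0 a b c d = ((a ^^^ c) ||| (b ^^^ d)) := rfl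
  simp [this]

theorem sub1_bit (a b c d i : ℕ) : (sub1 a b c d).testBit i =
    ((b.testBit i ^^ c.testBit i) ^^ (((b.testBit i ^^ c.testBit i) && (a.testBit i ^^ d.testBit i)) ^^
      (((b.testBit i ^^ c.testBit i) && (a.testBit i ^^ d.testBit i)) && b.testBit i))) := by
  have : sub1 a b c d = ((b ^^^ c) ^^^ (((b ^^^ c) &&& (a ^^^ d)) ^^^
      (((b ^^^ c) &&& (a ^^^ d)) &&& b))) := rfl
  simp [this]

theorem cinv_sub {a b c d : ℕ} (h : CInv a b) (h' : CInv c d) :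
    CInv (sub0 a b c d) (sub1 a b c d) := by
  intro i
  have h1 := h i
  have h2 := h' i
  rw [sub0_bit, sub1_bit]
  revert h1 h2
  generalize a.testBit i = a, b.testBit i = b, c.testBit i = c, d.testBit i = d
  cases a <;> cases b <;> cases c <;> cases d <;> simp +contextual

theorem dec_sub {a b c d : ℕ} (h : CInv a b) (h' : CInv c d) :
    dec (sub0 a b c d) (sub1 a b c d) = dec a b - dec c d := by
  funext i
  have h1 := (h i).1
  have h2 := (h' i).1
  show ((dn _ _ _ : ℕ) : ZMod 3) = ((dn _ _ _ : ℕ) : ZMod 3) - ((dn _ _ _ : ℕ) : ZMod 3)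
  rw [dn_eq, dn_eq, dn_eq, sub0_bit, sub1_bit]
  revert h1 h2
  generalize a.testBit i = a, b.testBit i = b, c.testBit i = c, d.testBit i = d
  revert a b c d
  decide

theorem cinv_neg {c d : ℕ} (h : CInv c d) : CInv c (Nat.xor c d) := by
  intro i
  have h1 := h i
  have : (Nat.xor c d).testBit i = (c.testBit i ^^ d.testBit i) := Nat.testBit_xor ..
  rw [this]
  revert h1
  generalize c.testBit i = c, d.testBit i = d
  cases c <;> cases d <;> simp +contextual

theorem dec_neg {c d : ℕ} (h : CInv c d) : dec c (Nat.xor c d) = - dec c d := by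
  funext i
  have h1 := (h i).1
  have : (Nat.xor c d).testBit i = (c.testBit i ^^ d.testBit i) := Nat.testBit_xor ..
  show ((dn _ _ _ : ℕ) : ZMod 3) = - ((dn _ _ _ : ℕ) : ZMod 3)
  rw [dn_eq, dn_eq, this]
  revert h1
  generalize c.testBit i = c, d.testBit i = d
  revert c d
  decide

theorem dec_ne_zero (p q : ℕ) (i : Fin 36) : dec p q i ≠ 0 ↔ p.testBit i = true := by
  show ((dn _ _ _ : ℕ) : ZMod 3) ≠ 0 ↔ _
  rw [dn_eq]
  generalize p.testBit i = p, q.testBit i = q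
  revert p q
  decide

def bits (p : ℕ) : Finset (Fin 36) := Finset.univ.filter fun i => p.testBit i = true

theorem norm_dec (p q : ℕ) : hammingNorm (dec p q) = (bits p).card := by
  unfold hammingNorm bits
  congr 1
  ext i
  simp only [Finset.mem_filter, Finset.mem_univ, true_and]
  exact dec_ne_zero p q i

theorem clr_step (k : ℕ → Bool) (n : ℕ)
    (hk : ∀ p, (∀ i, p.testBit i = true → i < 36) → k p = true → n ≤ (bits p).card)
    (p : ℕ) (hp : ∀ i, p.testBit i = true → i < 36) (h : clr k p = true) :
    n + 1 ≤ (bits p).card := by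
  cases p with
  | zero => exact absurd h (by simp [clr])
  | succ m =>
    have h' : k ((m + 1) &&& m) = true := h
    have h1 := hk _ (fun i hi => hp i (by
      rw [Nat.testBit_and, Bool.and_eq_true] at hi; exact hi.1)) h'
    refine lt_of_le_of_lt h1 (Finset.card_lt_card ?_)
    rw [Finset.ssubset_iff_of_subset]
    · have hne : (m + 1) &&& m ≠ m + 1 := by
        have : (m + 1) &&& m ≤ m := Nat.and_le_right
        omega
      obtain ⟨i, hi⟩ := Nat.exists_testBit_ne_of_ne hne
      rw [Nat.testBit_and] at hi
      have hi' : (m + 1).testBit i = true ∧ m.testBit i = false := by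
        revert hi
        generalize (m + 1).testBit i = a, m.testBit i = b
        revert a b
        decide
      refine ⟨⟨i, hp i hi'.1⟩, ?_, ?_⟩
      · simp [bits, hi'.1]
      · simp [bits, Nat.testBit_and, hi'.2]
    · intro i hi
      simp only [bits, Finset.mem_filter, Finset.mem_univ, true_and, Nat.testBit_and,
        Bool.and_eq_true] at hi ⊢
      exact hi.1

theorem heavy_spec (p : ℕ) (hp : ∀ i, p.testBit i = true → i < 36) (h : heavy p = true) :
    10 ≤ (bits p).card := by
  refine clr_step _ 9 (clr_step _ 8 (clr_step _ 7 (clr_step _ 6 (clr_step _ 5 (clr_step _ 4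
    (clr_step _ 3 (clr_step _ 2 (clr_step _ 1 (clr_step _ 0 ?_))))))))) p hp h
  intros
  exact Nat.zero_le _

def Light (v : Fin 36 → ZMod 3) : Prop :=
  hammingNorm v ≤ 9 → ∃ t ∈ lights, v = dec t.1 t.2

theorem test_spec {p q : ℕ} (hI : CInv p q) (h : test p q = true) : Light (dec p q) := by
  unfold test at h
  rw [force_eq, Bool.or_eq_true] at h
  intro hn
  rcases h with h | h
  · have := heavy_spec p (fun i => (hI i).2) h
    rw [norm_dec] at hn
    omega
  · unfold inL at h
    rw [List.any_eq_true] at h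
    obtain ⟨t, ht, h⟩ := h
    rw [Bool.and_eq_true] at h
    exact ⟨t, ht, by rw [beq_nat h.1, beq_nat h.2]⟩

def comb (x : Fin 36 → ZMod 3) (rs : List Row) : Fin 36 → ZMod 3 :=
  (rs.map fun t => x t.pos • dec t.p t.q).sum

theorem comb_cons (x : Fin 36 → ZMod 3) (t : Row) (rs : List Row) :
    comb x (t :: rs) = x t.pos • dec t.p t.q + comb x rs := by
  simp [comb]

theorem zmod3_cases (a : ZMod 3) : a = 0 ∨ a = 1 ∨ a = 2 := by
  revert a; decide

def cnt (x : Fin 36 → ZMod 3) (rs : List Row) : ℕ := rs.countP fun t => decide (x t.pos ≠ 0)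

theorem comb_zero (x : Fin 36 → ZMod 3) (rs : List Row) (h : cnt x rs = 0) : comb x rs = 0 := by
  induction rs with
  | nil => rfl
  | cons t rs ih =>
    by_cases h0 : x t.pos = 0
    · rw [comb_cons, h0, zero_smul, zero_add]
      apply ih
      simpa [cnt, List.countP_cons, h0] using h
    · simp [cnt, List.countP_cons, h0] at h

theorem srch_spec (x : Fin 36 → ZMod 3) (k : ℕ) : ∀ (rs : List Row) (p q : ℕ),
    srch k rs p q = true → CInv p q → (∀ t ∈ rs, CInv t.p t.q) → cnt x rs ≤ k →
    Light (dec p q + comb x rs) := by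
  induction k with
  | zero =>
    intro rs p q h hI _ hc
    rw [comb_zero x rs (by omega), add_zero]
    exact test_spec hI h
  | succ k ih =>
    intro rs p q h hI hR hc
    have h' : (test p q && (force p fun p => force q fun q =>
      List.rec (motive := fun _ => Bool) true
        (fun t rs' ih => and (srch k rs' (sub0 p q t.p t.q) (sub1 p q t.p t.q))
          (and (srch k rs' (sub0 p q t.p (Nat.xor t.p t.q))
            (sub1 p q t.p (Nat.xor t.p t.q))) ih)) rs)) = true := h
    rw [Bool.and_eq_true, force_eq, force_eq] at h'
    obtain ⟨h1, h2⟩ := h'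
    clear h
    induction rs with
    | nil => simpa [comb] using test_spec hI h1
    | cons t rs ih2 =>
      simp only [Bool.and_eq_true] at h2
      obtain ⟨h3, h4, h5⟩ := h2
      have hR' : ∀ s ∈ rs, CInv s.p s.q := fun s hs => hR s (List.mem_cons_of_mem _ hs)
      have ht : CInv t.p t.q := hR t List.mem_cons_self
      rw [comb_cons]
      have hc' : cnt x (t :: rs) = cnt x rs + if x t.pos ≠ 0 then 1 else 0 := by
        simp [cnt, List.countP_cons]
      rw [hc'] at hc
      rcases zmod3_cases (x t.pos) with h0 | h0 | h0
      · rw [h0, zero_smul, zero_add]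
        exact ih2 hR' (by simpa [h0] using hc) h5
      · have := ih rs _ _ h4 (cinv_sub hI (cinv_neg ht)) hR' (by simpa [h0] using hc)
        rw [dec_sub hI (cinv_neg ht), dec_neg ht] at this
        rw [h0, one_smul, ← add_assoc]
        simpa using this
      · have h20 : (2 : ZMod 3) ≠ 0 := by decide
        have := ih rs _ _ h3 (cinv_sub hI ht) hR' (by simpa [h0, h20] using hc)
        rw [dec_sub hI ht] at this
        have h2 : (2 : ZMod 3) = -1 := by decide
        rw [h0, h2, neg_one_smul, ← add_assoc, ← sub_eq_add_neg]
        exact this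

theorem A_eq (i j : Fin 36) : A104 i j = (ent i j : ℕ) := by
  have h := allN_eq _ _ (allN_eq _ _ entChk i i.2) j j.2
  unfold A104
  rw [beq_nat h]

theorem ent_01 (i j : ℕ) : ent i j = 0 ∨ ent i j = 1 := by
  unfold ent
  rw [bitv_eq]
  cases Nat.testBit bigA _ <;> simp

theorem A_one (i j : Fin 36) : A104 i j = 1 ↔ ent i j = 1 := by
  rw [A_eq]
  rcases ent_01 i j with h | h <;> rw [h] <;> decide

theorem part1 : ∀ i : Fin 36, (Finset.univ.filter fun j => A104 i j = 1).card = 15 := by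
  intro i
  have h := beq_nat (allN_eq _ _ rowChk i i.2)
  rw [sumN_eq] at h
  rw [Finset.card_filter, ← h]
  refine Finset.sum_congr rfl fun j _ => ?_
  simp only [A_one]
  rcases ent_01 i j with h | h <;> simp [h]

theorem part2a (x y : Fin 36) (hxy : y < x) :
      (Finset.univ.filter fun i => A104 i x = 1 ∧ A104 i y = 1).card = 6 := by
  have h := beq_nat (allN_eq _ _ (allN_eq _ _ colChk x x.2) y hxy)
  rw [sumN_eq] at h
  rw [Finset.card_filter, ← h]
  refine Finset.sum_congr rfl fun i _ => ?_
  simp only [A_one]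
  show _ = ent i x * ent i y
  rcases ent_01 i x with h | h <;> rcases ent_01 i y with h' | h' <;> simp [h, h']

theorem part2 : ∀ x y : Fin 36, x ≠ y →
      (Finset.univ.filter fun i => A104 i x = 1 ∧ A104 i y = 1).card = 6 := by
  intro x y hxy
  rcases lt_or_gt_of_ne hxy with h | h
  · rw [← part2a y x h]
    congr 1
    ext i
    simp [and_comm]
  · exact part2a x y h

theorem orthA (i j : Fin 36) : ∑ k, A104 i k * A104 j k = 0 := by
  have h := beq_nat (allN_eq _ _ (allN_eq _ _ orthChk i i.2) j j.2)
  rw [sumN_eq] at h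
  have h2 := congrArg (Nat.cast : ℕ → ZMod 3) h
  have h3 := (cast_mod3 _).symm.trans h2
  rw [Nat.cast_sum, Nat.cast_zero] at h3
  rw [← h3]
  refine Finset.sum_congr rfl fun k _ => ?_
  rw [A_eq, A_eq, ← Nat.cast_mul]
  rfl

theorem orthC (x y : Fin 36 → ZMod 3) (hx : x ∈ C104) (hy : y ∈ C104) :
    ∑ i, x i * y i = 0 := by
  unfold C104 at hx hy
  induction hx using Submodule.span_induction with
  | mem x hx =>
    obtain ⟨i, rfl⟩ := hx
    induction hy using Submodule.span_induction with
    | mem y hy =>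
      obtain ⟨j, rfl⟩ := hy
      exact orthA i j
    | zero => simp
    | add a b _ _ ha hb => simp only [Pi.add_apply, mul_add, Finset.sum_add_distrib, ha, hb, add_zero]
    | smul c a _ ha =>
      simp only [Pi.smul_apply, smul_eq_mul, mul_left_comm, ← Finset.mul_sum, ha, mul_zero]
  | zero => simp
  | add a b _ _ ha hb => simp only [Pi.add_apply, add_mul, Finset.sum_add_distrib, ha, hb, add_zero]
  | smul c a _ ha =>
    simp only [Pi.smul_apply, smul_eq_mul, mul_assoc, ← Finset.mul_sum, ha, mul_zero]

theorem mem_of_chk (G : List Row) (h : memChk G = true) (t : Row) (ht : t ∈ G) :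
    dec t.p t.q ∈ C104 := by
  have h1 := allL_eq _ _ h t ht
  have : dec t.p t.q = ∑ k : Fin 36, dec t.cp t.cq k • A104 k := by
    funext m
    have h2 := beq_nat (allN_eq _ _ h1 m m.2)
    rw [sumN_eq] at h2
    have h3 := congrArg (Nat.cast : ℕ → ZMod 3) h2
    have h4 := h3.trans (cast_mod3 _)
    rw [Nat.cast_sum] at h4
    rw [Finset.sum_apply]
    refine h4.trans (Finset.sum_congr rfl fun k _ => ?_)
    rw [Pi.smul_apply, A_eq, smul_eq_mul]
    exact Nat.cast_mul _ _
  rw [this]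
  exact Submodule.sum_mem _ fun k _ => Submodule.smul_mem _ _ (Submodule.subset_span ⟨k, rfl⟩)

theorem comb_mem (G : List Row) (h : memChk G = true) (x : Fin 36 → ZMod 3) :
    comb x G ∈ C104 := by
  refine list_sum_mem fun v hv => ?_
  obtain ⟨t, ht, rfl⟩ := List.mem_map.1 hv
  exact Submodule.smul_mem _ _ (mem_of_chk G h t ht)

theorem delta_eq (a b : Fin 36) : ((delta a b : ℕ) : ZMod 3) = if a = b then 1 else 0 := by
  unfold delta
  by_cases h : a = b
  · subst h
    have : Nat.beq a.val a.val = true := Nat.beq_refl _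
    simp [this]
  · have : Nat.beq a.val b.val = false := by
      by_contra hc
      exact h (Fin.ext (beq_nat (by simpa using hc)))
    simp [this, h]

theorem aux1 (x : Fin 36 → ZMod 3) (m : Fin 36) (G : List Row) :
    ∑ l : Fin 36, x l * ((sumL G fun t => Nat.mul (delta l t.pos.val) (dn t.p t.q m) : ℕ) : ZMod 3)
      = comb x G m := by
  induction G with
  | nil => simp [sumL, comb]
  | cons t G ih =>
    rw [comb_cons, Pi.add_apply, ← ih, Pi.smul_apply, smul_eq_mul]
    have : ∀ l : Fin 36, ((sumL (t :: G) fun t => Nat.mul (delta l t.pos.val) (dn t.p t.q m) : ℕ) :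
        ZMod 3) = (if l = t.pos then 1 else 0) * dec t.p t.q m +
        ((sumL G fun t => Nat.mul (delta l t.pos.val) (dn t.p t.q m) : ℕ) : ZMod 3) := by
      intro l
      rw [← delta_eq]
      exact (Nat.cast_add _ _).trans (congrArg (· + _) (Nat.cast_mul _ _))
    simp only [this, mul_add, Finset.sum_add_distrib]
    simp

theorem aux2 (x : Fin 36 → ZMod 3) (m : Fin 36) (H : List Row)
    (hx : ∀ t ∈ H, ∑ i, x i * dec t.p t.q i = 0) :
    ∑ l : Fin 36, x l * ((sumL H fun t => Nat.mul (dn t.p t.q l) (delta m t.pos.val) : ℕ) : ZMod 3)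
      = 0 := by
  induction H with
  | nil => simp [sumL]
  | cons t H ih =>
    have : ∀ l : Fin 36, ((sumL (t :: H) fun t => Nat.mul (dn t.p t.q l) (delta m t.pos.val) : ℕ) :
        ZMod 3) = dec t.p t.q l * (if m = t.pos then 1 else 0) +
        ((sumL H fun t => Nat.mul (dn t.p t.q l) (delta m t.pos.val) : ℕ) : ZMod 3) := by
      intro l
      rw [← delta_eq]
      exact (Nat.cast_add _ _).trans (congrArg (· + _) (Nat.cast_mul _ _))
    simp only [this, mul_add, Finset.sum_add_distrib, ← mul_assoc, ← Finset.sum_mul]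
    rw [ih fun s hs => hx s (List.mem_cons_of_mem _ hs), hx t List.mem_cons_self]
    simp

theorem ident_spec (G H : List Row) (h : identChk G H = true) (x : Fin 36 → ZMod 3)
    (hx : ∀ t ∈ H, ∑ i, x i * dec t.p t.q i = 0) : x = comb x G := by
  funext m
  have key : ∀ l : Fin 36, (if l = m then (1 : ZMod 3) else 0) =
      ((sumL G fun t => Nat.mul (delta l t.pos.val) (dn t.p t.q m) : ℕ) : ZMod 3) +
      ((sumL H fun t => Nat.mul (dn t.p t.q l) (delta m t.pos.val) : ℕ) : ZMod 3) := by
    intro l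
    have h2 := beq_nat (allN_eq _ _ (allN_eq _ _ h l l.2) m m.2)
    rw [← delta_eq, h2]
    exact (cast_mod3 _).trans (Nat.cast_add _ _)
  have : x m = ∑ l : Fin 36, x l * (if l = m then (1 : ZMod 3) else 0) := by simp
  rw [this]
  simp only [key, mul_add, Finset.sum_add_distrib]
  rw [aux1, aux2 x m H hx, add_zero]

theorem selfDual : IsSelfDualCode C104 := by
  intro x
  refine ⟨fun hx y hy => orthC x y hx hy, fun h => ?_⟩
  rw [ident_spec gen1 gen2 ident1 x fun t ht => h _ (mem_of_chk gen2 mem2 t ht)]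
  exact comb_mem gen1 mem1 x

theorem cnt_le (x : Fin 36 → ZMod 3) : cnt x gen1 + cnt x gen2 ≤ hammingNorm x := by
  have h : cnt x gen1 + cnt x gen2 =
      (((gen1.map Row.pos ++ gen2.map Row.pos).filter fun i => decide (x i ≠ 0)).toFinset).card := by
    rw [List.toFinset_card_of_nodup (gen1Nodup.filter _), ← List.countP_eq_length_filter,
      List.countP_append, List.countP_map, List.countP_map]
    rfl
  rw [h]
  unfold hammingNorm
  refine Finset.card_le_card fun i hi => ?_
  simp only [List.mem_toFinset, List.mem_filter, decide_eq_true_eq] at hi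
  simpa using hi.2

theorem cinv_zero : CInv 0 0 := by
  intro i; simp

theorem dec_zero : dec 0 0 = 0 := by
  funext i
  by_contra h
  have := (dec_ne_zero 0 0 i).1 h
  simp at this

theorem light_of_mem (x : Fin 36 → ZMod 3) (hx : x ∈ C104) : Light x := by
  intro hn
  have hc := cnt_le x
  have e1 := ident_spec gen1 gen2 ident1 x fun t ht => orthC _ _ hx (mem_of_chk gen2 mem2 t ht)
  have e2 := ident_spec gen2 gen1 ident2 x fun t ht => orthC _ _ hx (mem_of_chk gen1 mem1 t ht)
  rcases (by omega : cnt x gen1 ≤ 4 ∨ cnt x gen2 ≤ 4) with h | h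
  · have := srch_spec x 4 gen1 0 0 srch1 cinv_zero
      (fun t ht => inv_of_chk (allL_eq _ _ lt1 t ht)) h
    rw [dec_zero, zero_add, ← e1] at this
    exact this hn
  · have := srch_spec x 4 gen2 0 0 srch2 cinv_zero
      (fun t ht => inv_of_chk (allL_eq _ _ lt2 t ht)) h
    rw [dec_zero, zero_add, ← e2] at this
    exact this hn

theorem lights_spec (t : ℕ × ℕ) (ht : t ∈ lights.tail) :
    CInv t.1 t.2 ∧ hammingNorm (dec t.1 t.2) = 9 ∧ dec t.1 t.2 ∈ C104 := by
  have h := List.all_eq_true.1 lightsChk t ht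
  rw [Bool.and_eq_true, Bool.and_eq_true] at h
  obtain ⟨h1, h2, h3⟩ := h
  refine ⟨inv_of_chk h1, ?_, ?_⟩
  · rw [norm_dec, ← beq_nat h2, sumN_eq, bits, Finset.card_filter]
    refine Finset.sum_congr rfl fun i _ => ?_
    rw [bitv_eq]
    cases t.1.testBit i <;> simp
  · have : dec t.1 t.2 = comb (dec t.1 t.2) gen1 := by
      funext m
      have h4 := beq_nat (allN_eq _ _ h3 m m.2)
      have h5 := (congrArg (Nat.cast : ℕ → ZMod 3) h4).trans (cast_mod3 _)
      refine h5.trans ?_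
      rw [sumL_eq]
      unfold comb
      generalize gen1 = G
      induction G with
      | nil => rfl
      | cons r G ih =>
        rw [List.map_cons, List.sum_cons, Nat.cast_add, ih, List.map_cons, List.sum_cons,
          Pi.add_apply, Pi.smul_apply]
        exact congrArg (· + _) (Nat.cast_mul _ _)
    rw [this]
    exact comb_mem gen1 mem1 _

theorem lights_eq : lights = (0, 0) :: lights.tail := rfl

theorem light_or (x : Fin 36 → ZMod 3) (hx : x ∈ C104) (h0 : x ≠ 0) (hn : hammingNorm x ≤ 9) :
    ∃ t ∈ lights.tail, x = dec t.1 t.2 := by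
  obtain ⟨t, ht, e⟩ := light_of_mem x hx hn
  rw [lights_eq] at ht
  rcases List.mem_cons.1 ht with rfl | ht
  · exact absurd (e.trans dec_zero) h0
  · exact ⟨t, ht, e⟩

theorem minWt : MinWeightNine C104 := by
  constructor
  · have hm : lights.tail.head (by simp [lights]) ∈ lights.tail := List.head_mem _
    obtain ⟨_, h2, h3⟩ := lights_spec _ hm
    refine ⟨_, h3, ?_, h2⟩
    intro h
    rw [h, hammingNorm_zero] at h2
    omega
  · rintro w ⟨x, hx, h0, rfl⟩
    by_contra hlt
    obtain ⟨t, ht, e⟩ := light_or x hx h0 (by omega)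
    have := (lights_spec t ht).2.1
    rw [← e] at this
    omega

theorem dec_inj {a b c d : ℕ} (h : CInv a b) (h' : CInv c d) (e : dec a b = dec c d) :
    a = c ∧ b = d := by
  have key : ∀ i, a.testBit i = c.testBit i ∧ b.testBit i = d.testBit i := by
    intro i
    have h1 := h i
    have h2 := h' i
    by_cases hi : i < 36
    · have e1 : ((dn a b i : ℕ) : ZMod 3) = (dn c d i : ℕ) := congrFun e ⟨i, hi⟩
      rw [dn_eq, dn_eq] at e1
      replace h1 := h1.1
      replace h2 := h2.1
      revert h1 h2 e1
      generalize a.testBit i = a, b.testBit i = b, c.testBit i = c, d.testBit i = d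
      revert a b c d
      decide
    · simp only [hi, imp_false] at h1 h2
      revert h1 h2
      generalize a.testBit i = a, b.testBit i = b, c.testBit i = c, d.testBit i = d
      revert a b c d
      decide
  exact ⟨Nat.eq_of_testBit_eq fun i => (key i).1, Nat.eq_of_testBit_eq fun i => (key i).2⟩

theorem a9 : A9 C104 = 104 := by
  classical
  have hset : {x : Fin 36 → ZMod 3 | x ∈ C104 ∧ hammingNorm x = 9} =
      ↑(lights.tail.toFinset.image fun t => dec t.1 t.2) := by
    ext x
    simp only [Set.mem_ofPred_eq, Finset.coe_image, Set.mem_image, Finset.mem_coe,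
      List.mem_toFinset]
    constructor
    · rintro ⟨hx, hn⟩
      have h0 : x ≠ 0 := by
        rintro rfl
        rw [hammingNorm_zero] at hn
        omega
      obtain ⟨t, ht, e⟩ := light_or x hx h0 hn.le
      exact ⟨t, ht, e.symm⟩
    · rintro ⟨t, ht, rfl⟩
      exact ⟨(lights_spec t ht).2.2, (lights_spec t ht).2.1⟩
  have hc : A9 C104 = Set.ncard {x : Fin 36 → ZMod 3 | x ∈ C104 ∧ hammingNorm x = 9} := rfl
  rw [hc, hset, Set.ncard_coe_finset, Finset.card_image_of_injOn,
    List.toFinset_card_of_nodup lightsNodup]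
  · rfl
  · intro s hs t ht e
    simp only [Finset.mem_coe, List.mem_toFinset] at hs ht
    obtain ⟨h1, h2⟩ := dec_inj (lights_spec s hs).1 (lights_spec t ht).1 e
    exact Prod.ext h1 h2


theorem appendix_matrix_A9_eq_104 :
    (∀ i : Fin 36, (Finset.univ.filter fun j => A104 i j = 1).card = 15) ∧
    (∀ x y : Fin 36, x ≠ y →
      (Finset.univ.filter fun i => A104 i x = 1 ∧ A104 i y = 1).card = 6) ∧
    IsSelfDualCode C104 ∧ MinWeightNine C104 ∧ A9 C104 = 104 := by
  exact ⟨part1, part2, selfDual, minWt, a9⟩
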